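/- One-phase approximation. Let k ∈ ℕ and let 0 < a ≤ b be real constants. There is a constant C = C(k, a, b) > 0 such that the following holds for every integer n ≥ 3 with k ≤ n − 2, every choice of integers n > d_1 > ⋯ > d_k > 0, every f ∈ SEQOPT_k(d_1,…,d_k), every ℓ ∈ [0..k], every x_0 ∈ L_{d_ℓ}, every s_0 ∈ {OI, OW}, and all p, q ∈ (0,1) with a/(n·ln n) ≤ p ≤ b/(n·ln n) and a/(n·ln n) ≤ q ≤ b/(n·ln n). Let A = L_{d_1} if ℓ = 0 and A = L_{d_{ℓ−1}} ∪ L_{d_{ℓ+1}} if ℓ ≥ 1, and let N = inf{j ≥ 1 : there exists t ≤ T_s^{(j)} with x_t ∈ A} be the index of the phase by whose end the MMAHH with acceptance operators OI and OW on f first reaches A. Then E[N] ≤ C. -/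

import Mathlib

open MeasureTheory
open scoped ENNReal NNReal

namespace MMAHHStmt

/-- The two acceptance operators. -/
inductive Op : Type
  | OI : Op
  | OW : Op
  deriving DecidableEq

instance : MeasurableSpace Op := ⊤

/-- Search points: bit-strings of length `n`. -/
abbrev Point (n : ℕ) := Fin n → Bool

/-- The number of one-bits of a bit-string. -/
def ones {n : ℕ} (x : Point n) : ℕ := (Finset.univ.filter fun i => x i = true).card

/-- The all-ones string, the global optimum of all benchmarks considered. -/
def optimum (n : ℕ) : Point n := fun _ => true

/-- Flipping the bit in position `v`. -/
def flipBit {n : ℕ} (x : Point n) (v : Fin n) : Point n := Function.update x v (!(x v))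

open Classical in
/-- The search point obtained from `x` by proposing to flip bit `v` and applying the
acceptance operator `op` for the objective function `f`. -/
noncomputable def movedPoint {n : ℕ} (f : Point n → ℝ) (op : Op) (x : Point n) (v : Fin n) :
    Point n :=
  match op with
  | Op.OI => if f x < f (flipBit x v) then flipBit x v else x
  | Op.OW => if f (flipBit x v) < f x then flipBit x v else x

open Classical in
/-- One-step transition probability of the search point under acceptance operator `op`:
a uniformly random bit is flipped and the move is accepted or rejected according to `op`. -/
noncomputable def moveProb {n : ℕ} (f : Point n → ℝ) (op : Op) (x x' : Point n) : ℝ≥0∞ :=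
  ((Finset.univ.filter fun v => movedPoint f op x v = x').card : ℝ≥0∞) / n

/-- Transition probabilities of the two-state Markov chain on the acceptance operators. -/
noncomputable def switchProb (p q : ℝ) : Op → Op → ℝ≥0∞
  | Op.OI, Op.OI => ENNReal.ofReal (1 - p)
  | Op.OI, Op.OW => ENNReal.ofReal p
  | Op.OW, Op.OI => ENNReal.ofReal q
  | Op.OW, Op.OW => ENNReal.ofReal (1 - q)

/-- One-step transition probabilities of the MMAHH on the state space
`Point n × Op`: the search point moves according to the current acceptance operator, and,
independently, the operator switches according to the two-state Markov chain. -/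
noncomputable def mmahhTrans {n : ℕ} (f : Point n → ℝ) (p q : ℝ) :
    Point n × Op → Point n × Op → ℝ≥0∞ :=
  fun s s' => moveProb f s.2 s.1 s'.1 * switchProb p q s.2 s'.2

/-- `X` is (a version of) the MMAHH Markov chain with objective function `f` and switching
probabilities `p` and `q`, under the measure `μ`: each `X t` is measurable, and conditionally
on any history, the next state is distributed according to `mmahhTrans`. -/
def IsMMAHH {n : ℕ} {Ω : Type*} [MeasurableSpace Ω] (μ : Measure Ω)
    (X : ℕ → Ω → Point n × Op) (f : Point n → ℝ) (p q : ℝ) : Prop :=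
  (∀ t, Measurable (X t)) ∧
  ∀ (t : ℕ) (σ : ℕ → Point n × Op) (s' : Point n × Op),
    μ {ω | (∀ i ≤ t, X i ω = σ i) ∧ X (t + 1) ω = s'}
      = μ {ω | ∀ i ≤ t, X i ω = σ i} * mmahhTrans f p q (σ t) s'

/-- The runtime: the first hitting time of the global optimum, as an extended natural number
(`⊤` if the optimum is never reached). -/
noncomputable def hitTime {n : ℕ} {Ω : Type*} (X : ℕ → Ω → Point n × Op) (ω : Ω) : ℕ∞ :=
  ⨅ t ∈ {t : ℕ | (X t ω).1 = optimum n}, (t : ℕ∞)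

/-- The `k`-th switching time between the two acceptance operators (with junk value given by
`Nat.sInf ∅ = 0` on the probability-zero event that no further switch occurs). -/
noncomputable def switchTime {n : ℕ} {Ω : Type*} (X : ℕ → Ω → Point n × Op) : ℕ → Ω → ℕ
  | 0, _ => 0
  | k + 1, ω =>
      sInf {t : ℕ | switchTime X k ω ≤ t ∧ (X t ω).2 ≠ (X (switchTime X k ω) ω).2}

/-- `f : {0,1}^n → ℝ` belongs to the class `SEQOPT_k(d 1, …, d k)`, where `d 0 = n` and
`d (k+1) = 0`: the all-ones string is the unique global maximum, and between consecutive
layers the function is alternatingly increasing and decreasing, with sign changes exactly at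
the layers `d 1 > ⋯ > d k`. -/
def SeqOpt (n k : ℕ) (d : ℕ → ℕ) (f : Point n → ℝ) : Prop :=
  d 0 = n ∧ d (k + 1) = 0 ∧ (∀ i, i ≤ k → d (i + 1) < d i) ∧
  (∀ x : Point n, x ≠ optimum n → f x < f (optimum n)) ∧
  (∀ l, l ≤ k → ∀ h : ℕ, d (l + 1) ≤ h → h < d l →
    ((k - l) % 2 = 0 →
      ∀ x y : Point n, n - ones x = h → n - ones y = h + 1 → f x > f y) ∧
    ((k - l) % 2 = 1 →
      ∀ x y : Point n, n - ones x = h → n - ones y = h + 1 → f x < f y))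

section Prob

set_option linter.unusedSectionVars false

noncomputable instance instFintypeOp : Fintype Op :=
  ⟨{Op.OI, Op.OW}, by intro x; cases x <;> simp⟩

instance : MeasurableSingletonClass Op := ⟨fun _ => trivial⟩

lemma sum_op (F : Op → ℝ≥0∞) : ∑ o, F o = F Op.OI + F Op.OW := by
  have : (Finset.univ : Finset Op) = {Op.OI, Op.OW} := rfl
  rw [this, Finset.sum_pair (by decide)]

variable {n : ℕ} {Ω : Type} [MeasurableSpace Ω] {μ : Measure Ω}
  {X : ℕ → Ω → Point n × Op} {f : Point n → ℝ} {p q : ℝ}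

/-- history up to time `t` -/
def pre (X : ℕ → Ω → Point n × Op) (t : ℕ) (ω : Ω) : Fin (t + 1) → Point n × Op :=
  fun i => X i ω

lemma pre_measurable (hX : IsMMAHH μ X f p q) (t : ℕ) : Measurable (pre X t) :=
  measurable_pi_lambda _ fun i => hX.1 i

lemma lintegral_finite {α : Type} [Fintype α] [MeasurableSpace α] [MeasurableSingletonClass α]
    {Y : Ω → α} (hY : Measurable Y) (F : α → ℝ≥0∞) :
    ∫⁻ ω, F (Y ω) ∂μ = ∑ y, F y * μ {ω | Y ω = y} := by
  have h1 : ∫⁻ ω, F (Y ω) ∂μ = ∫⁻ y, F y ∂(μ.map Y) := by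
    rw [lintegral_map (measurable_of_countable F) hY]
  rw [h1, lintegral_fintype]
  refine Finset.sum_congr rfl fun y _ => ?_
  rw [Measure.map_apply hY (measurableSet_singleton y)]
  rfl

lemma markov (hX : IsMMAHH μ X f p q) (t : ℕ)
    (G : (Fin (t + 1) → Point n × Op) → Point n × Op → ℝ≥0∞) :
    ∫⁻ ω, G (pre X t ω) (X (t + 1) ω) ∂μ
      = ∫⁻ ω, ∑ s', mmahhTrans f p q (X t ω) s' * G (pre X t ω) s' ∂μ := by
  have h1 := lintegral_finite (μ := μ) ((pre_measurable hX t).prodMk (hX.1 (t + 1)))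
    (fun y => G y.1 y.2)
  have h2 := lintegral_finite (μ := μ) (pre_measurable hX t)
    (fun y => ∑ s', mmahhTrans f p q (y (Fin.last t)) s' * G y s')
  have e1 : ∀ ω, pre X t ω (Fin.last t) = X t ω := fun ω => rfl
  simp only [e1] at h2
  simp only at h1
  rw [h1, h2, Fintype.sum_prod_type]
  refine Finset.sum_congr rfl fun y _ => ?_
  rw [Finset.sum_mul]
  refine Finset.sum_congr rfl fun s' _ => ?_
  have key := hX.2 t (fun i => if h : i < t + 1 then y ⟨i, h⟩ else s') s'
  have eA : {ω | ∀ i ≤ t, X i ω = (fun i => if h : i < t + 1 then y ⟨i, h⟩ else s') i}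
      = {ω | pre X t ω = y} := by
    ext ω
    simp only [Set.mem_ofPred_eq]
    constructor
    · intro h
      funext i
      have := h i (by omega)
      simp only [i.2, dif_pos] at this
      exact this
    · intro h i hi
      have : i < t + 1 := by omega
      simp only [this, dif_pos]
      rw [← h]; rfl
  have eB : {ω | (∀ i ≤ t, X i ω = (fun i => if h : i < t + 1 then y ⟨i, h⟩ else s') i)
      ∧ X (t + 1) ω = s'} = {ω | (pre X t ω, X (t + 1) ω) = (y, s')} := by
    have : ∀ ω, (pre X t ω = y ↔ ∀ i ≤ t, X i ω = (fun i => if h : i < t + 1 then y ⟨i, h⟩ else s') i) := by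
      intro ω
      have := congrArg (fun S => ω ∈ S) eA
      simp only [Set.mem_ofPred_eq] at this
      rw [← this]
    ext ω
    simp only [Set.mem_ofPred_eq, Prod.mk.injEq]
    rw [this]
  rw [eA, eB] at key
  rw [key]
  have : (fun i => if h : i < t + 1 then y ⟨i, h⟩ else s') t = y (Fin.last t) := by
    simp [Fin.last]
  simp only [] at this
  rw [this]
  ring

open Classical in
/-- The indicator that the history stays in `D`. -/
noncomputable def stay (D : Set (Point n × Op)) (X : ℕ → Ω → Point n × Op) (t : ℕ) (ω : Ω) :
    ℝ≥0∞ := if ∀ i ≤ t, X i ω ∈ D then 1 else 0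

open Classical in
noncomputable def stayP (D : Set (Point n × Op)) (t : ℕ) (y : Fin (t + 1) → Point n × Op) :
    ℝ≥0∞ := if ∀ i, y i ∈ D then 1 else 0

lemma stay_eq (D : Set (Point n × Op)) (t : ℕ) (ω : Ω) :
    stay D X t ω = stayP D t (pre X t ω) := by
  unfold stay stayP
  congr 1
  apply propext
  constructor
  · intro h i
    exact h i (by omega)
  · intro h i hi
    exact h ⟨i, by omega⟩

lemma stay_succ_le (D : Set (Point n × Op)) (t : ℕ) (ω : Ω) :
    stay D X (t + 1) ω ≤ stay D X t ω := by
  unfold stay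
  split_ifs with h1 h2
  · exact le_rfl
  · exact absurd (fun i hi => h1 i (by omega)) h2
  · exact zero_le
  · exact le_rfl

lemma stay_measurable (hX : IsMMAHH μ X f p q) (D : Set (Point n × Op)) (t : ℕ) :
    Measurable (stay D X t) := by
  have : stay D X t = fun ω => stayP D t (pre X t ω) := funext fun ω => stay_eq D t ω
  rw [this]
  exact (measurable_of_countable (stayP D t)).comp (pre_measurable hX t)

open Classical in
noncomputable def cost (s s' : Point n × Op) : ℝ≥0∞ := if s'.2 ≠ s.2 then 1 else 0

lemma drift_step (hX : IsMMAHH μ X f p q) (D : Set (Point n × Op)) (V : Point n × Op → ℝ≥0∞)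
    (hV : ∀ s ∈ D, ∑ s', mmahhTrans f p q s s' * (cost s s' + V s') ≤ V s) (t : ℕ) :
    ∫⁻ ω, stay D X t ω * cost (X t ω) (X (t + 1) ω) ∂μ
      + ∫⁻ ω, stay D X (t + 1) ω * V (X (t + 1) ω) ∂μ
      ≤ ∫⁻ ω, stay D X t ω * V (X t ω) ∂μ := by
  have hm : Measurable fun ω => stay D X t ω * cost (X t ω) (X (t + 1) ω) := by
    refine (stay_measurable hX D t).mul ?_
    exact (measurable_of_countable (fun z : (Point n × Op) × (Point n × Op) => cost z.1 z.2)).comp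
      ((hX.1 t).prodMk (hX.1 (t + 1)))
  rw [← lintegral_add_left hm]
  calc _ ≤ ∫⁻ ω, stay D X t ω * (cost (X t ω) (X (t + 1) ω) + V (X (t + 1) ω)) ∂μ := by
        refine lintegral_mono fun ω => ?_
        rw [mul_add]
        gcongr
        exact stay_succ_le D t ω
    _ = ∫⁻ ω, ∑ s', mmahhTrans f p q (X t ω) s' *
          (stay D X t ω * (cost (X t ω) s' + V s')) ∂μ := by
        have := markov hX t (fun y s' => stayP D t y * (cost (y (Fin.last t)) s' + V s'))
        simp only [← stay_eq] at this
        exact this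
    _ ≤ _ := by
        refine lintegral_mono fun ω => ?_
        unfold stay
        split_ifs with h
        · simpa using hV _ (h t le_rfl)
        · simp

lemma drift (hX : IsMMAHH μ X f p q) (D : Set (Point n × Op)) (V : Point n × Op → ℝ≥0∞)
    (hV : ∀ s ∈ D, ∑ s', mmahhTrans f p q s s' * (cost s s' + V s') ≤ V s) (T : ℕ) :
    ∑ t ∈ Finset.range T, ∫⁻ ω, stay D X t ω * cost (X t ω) (X (t + 1) ω) ∂μ
      + ∫⁻ ω, stay D X T ω * V (X T ω) ∂μ ≤ ∫⁻ ω, V (X 0 ω) ∂μ := by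
  induction T with
  | zero =>
    simp only [Finset.range_zero, Finset.sum_empty, zero_add]
    refine lintegral_mono fun ω => ?_
    unfold stay
    split_ifs <;> simp
  | succ T ih =>
    rw [Finset.sum_range_succ, add_assoc]
    exact (add_le_add le_rfl (drift_step hX D V hV T)).trans ih

lemma drift_tsum (hX : IsMMAHH μ X f p q) [IsProbabilityMeasure μ]
    (D : Set (Point n × Op)) (V : Point n × Op → ℝ≥0∞)
    (hV : ∀ s ∈ D, ∑ s', mmahhTrans f p q s s' * (cost s s' + V s') ≤ V s)
    (C : ℝ≥0∞) (hC : ∀ s, V s ≤ C) :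
    ∫⁻ ω, ∑' t, stay D X t ω * cost (X t ω) (X (t + 1) ω) ∂μ ≤ C := by
  rw [lintegral_tsum]
  · refine ENNReal.tsum_le_of_sum_range_le fun T => ?_
    refine (le_self_add.trans (drift hX D V hV T)).trans ?_
    refine (lintegral_mono fun ω => hC _).trans ?_
    simp
  · intro t
    refine ((stay_measurable hX D t).mul ?_).aemeasurable
    exact (measurable_of_countable (fun z : (Point n × Op) × (Point n × Op) => cost z.1 z.2)).comp
      ((hX.1 t).prodMk (hX.1 (t + 1)))

/-- Almost surely, only transitions of positive probability are taken. -/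
lemma ae_trans (hX : IsMMAHH μ X f p q) :
    ∀ᵐ ω ∂μ, ∀ t, mmahhTrans f p q (X t ω) (X (t + 1) ω) ≠ 0 := by
  classical
  rw [ae_all_iff]
  intro t
  have h := markov hX t
    (fun y s' => if mmahhTrans f p q (y (Fin.last t)) s' = 0 then 1 else 0)
  have e : ∀ ω, pre X t ω (Fin.last t) = X t ω := fun ω => rfl
  simp only [e] at h
  have h0 : ∀ ω, ∑ s', mmahhTrans f p q (X t ω) s' *
      (if mmahhTrans f p q (X t ω) s' = 0 then 1 else 0) = 0 := by
    intro ω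
    refine Finset.sum_eq_zero fun s' _ => ?_
    split_ifs with h <;> simp [h]
  simp only [h0, lintegral_zero] at h
  rw [lintegral_eq_zero_iff'] at h
  · filter_upwards [h] with ω hω h'
    simp [h'] at hω
  · exact ((measurable_of_countable (fun z : (Point n × Op) × (Point n × Op) =>
      (if mmahhTrans f p q z.1 z.2 = 0 then (1 : ℝ≥0∞) else 0))).comp
      ((hX.1 t).prodMk (hX.1 (t + 1)))).aemeasurable

lemma moveProb_sum_le (o : Op) (x : Point n) : ∑ x', moveProb f o x x' ≤ 1 := by
  classical
  unfold moveProb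
  simp only [div_eq_mul_inv]
  rw [← Finset.sum_mul, ← Nat.cast_sum]
  have : ∑ x' : Point n, (Finset.univ.filter fun v => movedPoint f o x v = x').card
      = (Finset.univ : Finset (Fin n)).card :=
    (Finset.card_eq_sum_card_fiberwise (fun v _ => Finset.mem_univ (movedPoint f o x v))).symm
  convert ENNReal.mul_inv_le_one (n : ℝ≥0∞)
  convert this
  simp

lemma ae_switch (hX : IsMMAHH μ X f p q) [IsProbabilityMeasure μ] (hp : 0 < p) (hq : 0 < q) :
    ∀ᵐ ω ∂μ, ∀ t, ∃ u, t ≤ u ∧ (X u ω).2 ≠ (X t ω).2 := by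
  classical
  rw [ae_all_iff]
  intro t
  set ρ : ℝ≥0∞ := max (ENNReal.ofReal (1 - p)) (ENNReal.ofReal (1 - q)) with hρ
  have hρ1 : ρ < 1 := by
    rw [hρ]
    apply max_lt
    · rw [← ENNReal.ofReal_one]; exact (ENNReal.ofReal_lt_ofReal_iff one_pos).2 (by linarith)
    · rw [← ENNReal.ofReal_one]; exact (ENNReal.ofReal_lt_ofReal_iff one_pos).2 (by linarith)
  have hstay : ∀ s : Point n × Op, ∑ s' : Point n × Op, mmahhTrans f p q s s' *
      (if s'.2 = s.2 then 1 else 0) ≤ ρ := by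
    intro s
    rw [Fintype.sum_prod_type]
    simp only [sum_op, mmahhTrans]
    have : ∀ x', moveProb f s.2 s.1 x' * switchProb p q s.2 Op.OI * (if Op.OI = s.2 then 1 else 0)
        + moveProb f s.2 s.1 x' * switchProb p q s.2 Op.OW * (if Op.OW = s.2 then 1 else 0)
        ≤ moveProb f s.2 s.1 x' * ρ := by
      intro x'
      rcases s with ⟨x, o⟩
      cases o
      · simp only [if_true, reduceCtorEq, if_false, mul_zero, add_zero, mul_one]
        gcongr
        exact le_max_left _ _
      · simp only [if_true, reduceCtorEq, if_false, mul_zero, zero_add, mul_one]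
        gcongr
        exact le_max_right _ _
    refine (Finset.sum_le_sum fun x' _ => this x').trans ?_
    rw [← Finset.sum_mul]
    exact (mul_le_mul_left (moveProb_sum_le _ _) _).trans (by simp)
  have hbd : ∀ m, ∫⁻ ω, (if ∀ i ≤ m, (X (t + i) ω).2 = (X t ω).2 then 1 else 0) ∂μ ≤ ρ ^ m := by
    intro m
    induction m with
    | zero => simp
    | succ m ih =>
      have h := markov hX (t + m) (fun y s' =>
        if (∀ i : Fin (m + 1), (y ⟨t + i, by omega⟩).2 = (y ⟨t, by omega⟩).2) ∧
          s'.2 = (y (Fin.last _)).2 then 1 else 0)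
      simp only [pre, Fin.val_last] at h
      have e1 : ∀ ω, (if ∀ i ≤ m + 1, (X (t + i) ω).2 = (X t ω).2 then (1 : ℝ≥0∞) else 0)
        ≤ (if (∀ i : Fin (m + 1), (X (t + i) ω).2 = (X t ω).2) ∧
          (X (t + m + 1) ω).2 = (X (t + m) ω).2 then 1 else 0) := by
        intro ω
        split_ifs with h1 h2
        · exact le_rfl
        · exfalso
          apply h2
          refine ⟨fun i => h1 i (by omega), ?_⟩
          rw [h1 m (by omega), ← h1 (m + 1) le_rfl]
          rfl
        · exact zero_le
        · exact le_rfl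
      refine (lintegral_mono e1).trans ?_
      refine le_trans (le_of_eq (Eq.trans ?_ h)) ?_
      · congr!
      have e2 : ∀ ω, ∑ s' : Point n × Op, mmahhTrans f p q (X (t + m) ω) s' *
          (if (∀ i : Fin (m + 1), (X (t + i) ω).2 = (X t ω).2) ∧
          s'.2 = (X (t + m) ω).2 then 1 else 0) ≤
          (if ∀ i ≤ m, (X (t + i) ω).2 = (X t ω).2 then 1 else 0) * ρ := by
        intro ω
        split_ifs with h1
        · rw [one_mul]
          refine le_trans ?_ (hstay (X (t + m) ω))
          refine Finset.sum_le_sum fun s' _ => ?_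
          gcongr
          split_ifs with h2 h3 h3
          · exact le_rfl
          · exact absurd h2.2 h3
          · exact zero_le
          · exact le_rfl
        · rw [zero_mul]
          refine le_of_eq (Finset.sum_eq_zero fun s' _ => ?_)
          rw [if_neg, mul_zero]
          intro h2
          exact h1 fun i hi => h2.1 ⟨i, by omega⟩
      refine (lintegral_mono (fun ω => by convert e2 ω; split_ifs with hh <;> simp [hh])).trans ?_
      rw [lintegral_mul_const' _ _ (ne_top_of_lt hρ1), pow_succ]
      gcongr
  have hsub : ∀ m, μ {ω | ¬ ∃ u, t ≤ u ∧ (X u ω).2 ≠ (X t ω).2} ≤ ρ ^ m := by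
    intro m
    refine le_trans ?_ (hbd m)
    set S := {ω | ∀ i ≤ m, (X (t + i) ω).2 = (X t ω).2} with hS
    have hSm : MeasurableSet S := by
      have : S = ⋂ i ∈ Set.Iic m, {ω | (X (t + i) ω).2 = (X t ω).2} := by
        ext ω; simp [hS]
      rw [this]
      refine MeasurableSet.biInter (Set.to_countable _) fun i _ => ?_
      exact measurableSet_eq_fun (measurable_snd.comp (hX.1 _)) (measurable_snd.comp (hX.1 _))
    have e : ∀ ω, (if ∀ i ≤ m, (X (t + i) ω).2 = (X t ω).2 then (1 : ℝ≥0∞) else 0)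
        = S.indicator 1 ω := by
      intro ω
      simp [Set.indicator_apply, hS]
    simp only [e]
    rw [lintegral_indicator_one hSm]
    refine measure_mono ?_
    intro ω hω i hi
    by_contra hne
    exact hω ⟨t + i, by omega, hne⟩
  have hlim := ENNReal.tendsto_pow_atTop_nhds_zero_of_lt_one hρ1
  have : μ {ω | ¬ ∃ u, t ≤ u ∧ (X u ω).2 ≠ (X t ω).2} ≤ 0 :=
    ge_of_tendsto' hlim hsub
  exact le_antisymm this zero_le

end Prob

section Path

set_option linter.unusedSectionVars false

variable {n : ℕ} {Ω : Type} {X : ℕ → Ω → Point n × Op}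

open Classical in
/-- number of switches strictly before reaching time `t` -/
noncomputable def sw (X : ℕ → Ω → Point n × Op) (ω : Ω) (t : ℕ) : ℕ :=
  ∑ i ∈ Finset.range t, if (X (i + 1) ω).2 ≠ (X i ω).2 then 1 else 0

lemma sw_mono (ω : Ω) : Monotone (sw X ω) := by
  refine monotone_nat_of_le_succ fun t => ?_
  unfold sw
  rw [Finset.sum_range_succ]
  omega

lemma sw_eq (ω : Ω) (a m : ℕ) (h : sw X ω (a + m) = sw X ω a) :
    (X (a + m) ω).2 = (X a ω).2 := by
  induction m with
  | zero => rfl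
  | succ m ih =>
    have h1 : sw X ω a ≤ sw X ω (a + m) := sw_mono ω (by omega)
    have h2 : sw X ω (a + (m + 1)) = sw X ω (a + m) +
        if (X (a + m + 1) ω).2 ≠ (X (a + m) ω).2 then 1 else 0 := by
      unfold sw
      rw [← add_assoc, Finset.sum_range_succ]
    by_cases hc : (X (a + m + 1) ω).2 ≠ (X (a + m) ω).2
    · rw [if_pos hc] at h2; omega
    · rw [if_neg hc] at h2
      rw [← ih (by omega), ← add_assoc]
      exact not_not.1 hc

lemma sw_switchTime (ω : Ω) (hω : ∀ t, ∃ u, t ≤ u ∧ (X u ω).2 ≠ (X t ω).2) (j : ℕ) :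
    j ≤ sw X ω (switchTime X j ω) := by
  induction j with
  | zero => exact Nat.zero_le _
  | succ j ih =>
    have hne : {t : ℕ | switchTime X j ω ≤ t ∧
      (X t ω).2 ≠ (X (switchTime X j ω) ω).2}.Nonempty := hω _
    have hm := Nat.sInf_mem hne
    have e : switchTime X (j + 1) ω = sInf {t : ℕ | switchTime X j ω ≤ t ∧
      (X t ω).2 ≠ (X (switchTime X j ω) ω).2} := rfl
    rw [← e] at hm
    obtain ⟨h1, h2⟩ := hm
    obtain ⟨m, hm⟩ := Nat.exists_eq_add_of_le h1
    have h3 : sw X ω (switchTime X j ω) ≤ sw X ω (switchTime X (j + 1) ω) := sw_mono ω h1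
    by_contra hlt
    apply h2
    rw [hm]
    apply sw_eq
    rw [← hm]
    omega

lemma sw_le_tsum (ω : Ω) (D : Set (Point n × Op)) (T : ℕ) (hT : ∀ i < T, X i ω ∈ D) :
    (sw X ω T : ℝ≥0∞) ≤ ∑' t, stay D X t ω * cost (X t ω) (X (t + 1) ω) := by
  refine le_trans ?_ (ENNReal.sum_le_tsum (Finset.range T))
  unfold sw
  rw [Nat.cast_sum]
  refine Finset.sum_le_sum fun i hi => ?_
  have : stay D X i ω = 1 := by
    unfold stay
    rw [if_pos]
    intro i' hi'
    exact hT i' (by have := Finset.mem_range.1 hi; omega)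
  rw [this, one_mul]
  unfold cost
  split_ifs <;> simp

lemma path_bound (ω : Ω) (hω : ∀ t, ∃ u, t ≤ u ∧ (X u ω).2 ≠ (X t ω).2)
    (D : Set (Point n × Op)) (A : Point n → Prop) (h0 : X 0 ω ∈ D)
    (hstep : ∀ t, X t ω ∈ D → X (t + 1) ω ∈ D ∨ A (X (t + 1) ω).1) :
    (⨅ j ∈ {j : ℕ | 1 ≤ j ∧ ∃ t ≤ switchTime X j ω, A (X t ω).1}, ((j : ℕ∞) : ℝ≥0∞))
      ≤ ∑' t, stay D X t ω * cost (X t ω) (X (t + 1) ω) + 1 := by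
  classical
  by_cases hA : ∃ t, A (X t ω).1
  · set T := Nat.find hA with hT
    have hTA : A (X T ω).1 := Nat.find_spec hA
    have hD : ∀ i < T, X i ω ∈ D := by
      intro i
      induction i with
      | zero => intro _; exact h0
      | succ i ih =>
        intro hi
        rcases hstep i (ih (by omega)) with h | h
        · exact h
        · exact absurd h (Nat.find_min hA hi)
    refine (iInf₂_le (sw X ω T + 1) ?_).trans ?_
    · refine ⟨by omega, T, ?_, hTA⟩
      by_contra hlt
      have h1 := sw_switchTime ω hω (sw X ω T + 1)
      have h2 : sw X ω (switchTime X (sw X ω T + 1) ω) ≤ sw X ω T := sw_mono ω (by omega)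
      omega
    · have := sw_le_tsum ω D T hD
      push_cast
      gcongr
  · have hD : ∀ i, X i ω ∈ D := by
      intro i
      induction i with
      | zero => exact h0
      | succ i ih =>
        rcases hstep i ih with h | h
        · exact h
        · exact absurd ⟨_, h⟩ hA
    have : ∑' t, stay D X t ω * cost (X t ω) (X (t + 1) ω) = ⊤ := by
      refine ENNReal.eq_top_of_forall_nnreal_le fun r => ?_
      obtain ⟨j, hj⟩ := exists_nat_ge r
      have h1 := sw_switchTime ω hω j
      have h2 := sw_le_tsum ω D (switchTime X j ω) fun i _ => hD i
      refine le_trans ?_ h2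
      have h3 : r ≤ (sw X ω (switchTime X j ω) : ℝ≥0) := hj.trans (by exact_mod_cast h1)
      exact_mod_cast h3
    rw [this]
    simp

end Path

section Layers

set_option linter.unnecessarySeqFocus false

/-- The layer index of a search point. -/
def lay {n : ℕ} (x : Point n) : ℕ := n - ones x

lemma card_true {n : ℕ} (x : Point n) : ones x ≤ n := by
  unfold ones
  exact (Finset.card_le_univ _).trans (by simp)

lemma lay_le {n : ℕ} (x : Point n) : lay x ≤ n := Nat.sub_le _ _

lemma card_false {n : ℕ} (x : Point n) :
    (Finset.univ.filter fun i => x i = false).card = lay x := by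
  have := Finset.card_filter_add_card_filter_not (s := (Finset.univ : Finset (Fin n)))
    (fun i => x i = true)
  simp only [Bool.not_eq_true, Finset.card_univ, Fintype.card_fin] at this
  unfold lay ones
  omega

lemma card_true' {n : ℕ} (x : Point n) :
    (Finset.univ.filter fun i => x i = true).card = n - lay x := by
  have := card_true x
  unfold lay
  change ones x = _
  omega

lemma ones_flip_false {n : ℕ} (x : Point n) (v : Fin n) (hv : x v = false) :
    ones (flipBit x v) = ones x + 1 := by
  unfold ones
  have : (Finset.univ.filter fun i => flipBit x v i = true)
      = insert v (Finset.univ.filter fun i => x i = true) := by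
    ext i
    by_cases h : i = v
    · subst h; simp [flipBit, hv]
    · simp only [Finset.mem_filter, Finset.mem_univ, true_and, Finset.mem_insert, h, false_or]
      rw [flipBit, Function.update_of_ne h]
  rw [this, Finset.card_insert_of_notMem]
  simp [hv]

lemma ones_flip_true {n : ℕ} (x : Point n) (v : Fin n) (hv : x v = true) :
    ones (flipBit x v) + 1 = ones x := by
  have h := ones_flip_false (flipBit x v) v (by simp [flipBit, hv])
  have : flipBit (flipBit x v) v = x := by simp [flipBit]
  rw [this] at h
  exact h.symm

lemma lay_flip_false {n : ℕ} (x : Point n) (v : Fin n) (hv : x v = false) :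
    lay (flipBit x v) + 1 = lay x := by
  have h1 := ones_flip_false x v hv
  have h2 := card_true (flipBit x v)
  unfold lay
  omega

lemma lay_flip_true {n : ℕ} (x : Point n) (v : Fin n) (hv : x v = true) :
    lay (flipBit x v) = lay x + 1 := by
  have h1 := ones_flip_true x v hv
  have h2 := card_true x
  unfold lay
  omega

/-- The upper end of the region. -/
def hiB (n l : ℕ) (d : ℕ → ℕ) : ℕ := if l = 0 then n + 1 else d (l - 1)

/-- The operator leading away from `L_{d_l}`. -/
def goodOp (k l : ℕ) : Op := if (k - l) % 2 = 0 then Op.OI else Op.OW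

variable {n k l : ℕ} {d : ℕ → ℕ} {f : Point n → ℝ}

lemma hi_spec (hf : SeqOpt n k d f) (hl : l ≤ k) :
    d (l + 1) < d l ∧ d l < hiB n l d ∧ d l ≤ n ∧ hiB n l d ≤ n + 1 := by
  obtain ⟨h0, h1, h2, -, -⟩ := hf
  have hn : ∀ i, i ≤ k → d i ≤ n := by
    intro i
    induction i with
    | zero => intro _; omega
    | succ i ih => intro hi; have := ih (by omega); have := h2 i (by omega); omega
  refine ⟨h2 l hl, ?_, hn l hl, ?_⟩
  · unfold hiB
    split_ifs with h
    · have := hn l hl; omega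
    · have := h2 (l - 1) (by omega)
      rwa [show l - 1 + 1 = l by omega] at this
  · unfold hiB
    split_ifs with h
    · omega
    · have := hn (l - 1) (by omega); omega

/-- comparison of adjacent layers, below `d l` -/
lemma cmp_low (hf : SeqOpt n k d f) (hl : l ≤ k) (x y : Point n) (h1 : d (l + 1) ≤ lay x)
    (h2 : lay x < d l) (hxy : lay y = lay x + 1) :
    ((k - l) % 2 = 0 → f y < f x) ∧ ((k - l) % 2 = 1 → f x < f y) := by
  obtain ⟨-, -, -, -, h⟩ := hf
  have := h l hl (lay x) h1 h2
  exact ⟨fun e => this.1 e x y rfl hxy, fun e => this.2 e x y rfl hxy⟩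

lemma cmp_high (hf : SeqOpt n k d f) (hl : l ≤ k) (x y : Point n) (h1 : d l ≤ lay x)
    (h2 : lay x < hiB n l d) (hxy : lay y = lay x + 1) :
    ((k - l) % 2 = 0 → f x < f y) ∧ ((k - l) % 2 = 1 → f y < f x) := by
  have hy := lay_le y
  obtain ⟨h0, -, -, -, h⟩ := hf
  unfold hiB at h2
  split_ifs at h2 with hl0
  · subst hl0; omega
  · have := h (l - 1) (by omega) (lay x) (by rw [show l - 1 + 1 = l by omega]; exact h1) h2
    exact ⟨fun e => this.2 (by omega) x y rfl hxy, fun e => this.1 (by omega) x y rfl hxy⟩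

/-- Summary of the move dynamics in the region. -/
lemma move_false (hf : SeqOpt n k d f) (hl : l ≤ k) (x : Point n) (v : Fin n) (o : Op)
    (h1 : d (l + 1) < lay x) (h2 : lay x < hiB n l d) (hv : x v = false) :
    lay (movedPoint f o x v) =
      if (o = goodOp k l ↔ lay x ≤ d l) then lay x - 1 else lay x := by
  have hfl := lay_flip_false x v hv
  by_cases hc : lay x ≤ d l
  · have := cmp_low hf hl (flipBit x v) x (by omega) (by omega) (by omega)
    rcases Nat.mod_two_eq_zero_or_one (k - l) with e | e
    · have h3 := this.1 e
      cases o <;> simp [movedPoint, goodOp, e, hc, h3, h3.le.not_gt] <;> omega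
    · have h3 := this.2 e
      cases o <;> simp [movedPoint, goodOp, e, hc, h3, h3.le.not_gt] <;> omega
  · have := cmp_high hf hl (flipBit x v) x (by omega) (by omega) (by omega)
    rcases Nat.mod_two_eq_zero_or_one (k - l) with e | e
    · have h3 := this.1 e
      cases o <;> simp [movedPoint, goodOp, e, hc, h3, h3.le.not_gt] <;> omega
    · have h3 := this.2 e
      cases o <;> simp [movedPoint, goodOp, e, hc, h3, h3.le.not_gt] <;> omega

lemma move_true (hf : SeqOpt n k d f) (hl : l ≤ k) (x : Point n) (v : Fin n) (o : Op)
    (h1 : d (l + 1) < lay x) (h2 : lay x < hiB n l d) (hv : x v = true) :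
    lay (movedPoint f o x v) =
      if (o = goodOp k l ↔ d l ≤ lay x) then lay x + 1 else lay x := by
  have hfl := lay_flip_true x v hv
  by_cases hc : d l ≤ lay x
  · have := cmp_high hf hl x (flipBit x v) (by omega) (by omega) (by omega)
    rcases Nat.mod_two_eq_zero_or_one (k - l) with e | e
    · have h3 := this.1 e
      cases o <;> simp [movedPoint, goodOp, e, hc, h3, h3.le.not_gt, hfl]
    · have h3 := this.2 e
      cases o <;> simp [movedPoint, goodOp, e, hc, h3, h3.le.not_gt, hfl]
  · have := cmp_low hf hl x (flipBit x v) (by omega) (by omega) (by omega)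
    rcases Nat.mod_two_eq_zero_or_one (k - l) with e | e
    · have h3 := this.1 e
      cases o <;> simp [movedPoint, goodOp, e, hc, h3, h3.le.not_gt, hfl]
    · have h3 := this.2 e
      cases o <;> simp [movedPoint, goodOp, e, hc, h3, h3.le.not_gt, hfl]

lemma trans_ne_zero {p q : ℝ} {s s' : Point n × Op} (h : mmahhTrans f p q s s' ≠ 0) :
    ∃ v, movedPoint f s.2 s.1 v = s'.1 := by
  classical
  by_contra hc
  push Not at hc
  apply h
  unfold mmahhTrans moveProb
  rw [Finset.filter_false_of_mem (fun v _ => hc v)]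
  simp

end Layers

section Drift

def other : Op → Op
  | Op.OI => Op.OW
  | Op.OW => Op.OI

def rate (p q : ℝ) : Op → ℝ
  | Op.OI => p
  | Op.OW => q

variable {n k l : ℕ} {d : ℕ → ℕ} {f : Point n → ℝ} {p q : ℝ}

lemma trans_sum (s : Point n × Op) (F : Point n × Op → ℝ≥0∞) :
    ∑ s', mmahhTrans f p q s s' * F s' = ∑ v : Fin n, (n : ℝ≥0∞)⁻¹ *
      ∑ o', switchProb p q s.2 o' * F (movedPoint f s.2 s.1 v, o') := by
  classical
  rw [Fintype.sum_prod_type]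
  have h : ∀ x', ∑ o', mmahhTrans f p q s (x', o') * F (x', o')
      = ∑ v : Fin n, if movedPoint f s.2 s.1 v = x' then (n : ℝ≥0∞)⁻¹ *
        ∑ o', switchProb p q s.2 o' * F (movedPoint f s.2 s.1 v, o') else 0 := by
    intro x'
    have e : ∀ v : Fin n, (if movedPoint f s.2 s.1 v = x' then (n : ℝ≥0∞)⁻¹ *
        ∑ o', switchProb p q s.2 o' * F (movedPoint f s.2 s.1 v, o') else 0)
        = (if movedPoint f s.2 s.1 v = x' then 1 else 0) * ((n : ℝ≥0∞)⁻¹ *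
        ∑ o', switchProb p q s.2 o' * F (x', o')) := by
      intro v
      split_ifs with h
      · rw [h, one_mul]
      · rw [zero_mul]
    simp only [e]
    rw [← Finset.sum_mul, Finset.sum_boole]
    simp only [mmahhTrans, moveProb, div_eq_mul_inv, mul_assoc]
    rw [← Finset.mul_sum, ← Finset.mul_sum]
  simp only [h]
  rw [Finset.sum_comm]
  refine Finset.sum_congr rfl fun v _ => ?_
  rw [Finset.sum_ite_eq]
  simp

/-- The one-step contribution when moving to layer `z` under operator `o`. -/
def stepE (W : ℕ → Op → ℝ) (p q : ℝ) (o : Op) (z : ℕ) : ℝ :=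
  (1 - rate p q o) * W z o + rate p q o * (1 + W z (other o))

lemma stepE_ofReal (W : ℕ → Op → ℝ) (hW : ∀ y o, 0 ≤ W y o) (hp : 0 < p) (hp1 : p < 1)
    (hq : 0 < q) (hq1 : q < 1) (s : Point n × Op) (x' : Point n) :
    ∑ o', switchProb p q s.2 o' * (cost s (x', o') + ENNReal.ofReal (W (lay x') o'))
      = ENNReal.ofReal (stepE W p q s.2 (lay x')) ∧ 0 ≤ stepE W p q s.2 (lay x') := by
  have g1 := hW (lay x') Op.OI
  have g2 := hW (lay x') Op.OW
  rcases s with ⟨x, o⟩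
  cases o
  · constructor
    · rw [sum_op, stepE, ENNReal.ofReal_add, ENNReal.ofReal_mul, ENNReal.ofReal_mul,
        ENNReal.ofReal_add]
      · simp [cost, switchProb, rate, other]
      all_goals try simp only [rate, other]
      all_goals positivity
    · simp only [stepE, rate, other]
      have : 0 ≤ 1 - p := by linarith
      positivity
  · constructor
    · rw [sum_op, add_comm, stepE, ENNReal.ofReal_add, ENNReal.ofReal_mul, ENNReal.ofReal_mul,
        ENNReal.ofReal_add]
      · simp [cost, switchProb, rate, other]
      all_goals try simp only [rate, other]
      all_goals positivity
    · simp only [stepE, rate, other]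
      have : 0 ≤ 1 - q := by linarith
      positivity

lemma region_drift (hn : 0 < n) (hf : SeqOpt n k d f) (hl : l ≤ k)
    (hp : 0 < p) (hp1 : p < 1) (hq : 0 < q) (hq1 : q < 1)
    (W : ℕ → Op → ℝ) (hW : ∀ y o, 0 ≤ W y o)
    (hdr : ∀ y o, d (l + 1) < y → y < hiB n l d → y ≤ n →
      (y : ℝ) * stepE W p q o (if (o = goodOp k l ↔ y ≤ d l) then y - 1 else y)
      + ((n : ℝ) - y) * stepE W p q o (if (o = goodOp k l ↔ d l ≤ y) then y + 1 else y)
      ≤ n * W y o)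
    (s : Point n × Op) (h1 : d (l + 1) < lay s.1) (h2 : lay s.1 < hiB n l d) :
    ∑ s', mmahhTrans f p q s s' * (cost s s' + ENNReal.ofReal (W (lay s'.1) s'.2))
      ≤ ENNReal.ofReal (W (lay s.1) s.2) := by
  classical
  have hn' : (0 : ℝ) < n := by exact_mod_cast hn
  rw [trans_sum]
  simp only [(stepE_ofReal W hW hp hp1 hq hq1 s _).1]
  rw [← Finset.mul_sum, ← ENNReal.ofReal_sum_of_nonneg
    (fun v _ => (stepE_ofReal W hW hp hp1 hq hq1 s _).2)]
  rw [show (n : ℝ≥0∞)⁻¹ = ENNReal.ofReal ((n : ℝ)⁻¹) by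
    rw [ENNReal.ofReal_inv_of_pos hn', ENNReal.ofReal_natCast]]
  rw [← ENNReal.ofReal_mul (by positivity)]
  apply ENNReal.ofReal_le_ofReal
  rw [inv_mul_le_iff₀ hn']
  refine le_trans (le_of_eq ?_) (hdr (lay s.1) s.2 h1 h2 (lay_le _))
  rw [← Finset.sum_filter_add_sum_filter_not Finset.univ (fun v => s.1 v = false)]
  congr 1
  · rw [Finset.sum_congr rfl (g := fun _ => stepE W p q s.2
      (if (s.2 = goodOp k l ↔ lay s.1 ≤ d l) then lay s.1 - 1 else lay s.1))]
    · rw [Finset.sum_const, card_false, nsmul_eq_mul]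
    · intro v hv
      rw [move_false hf hl s.1 v s.2 h1 h2 (Finset.mem_filter.1 hv).2]
  · rw [Finset.sum_congr rfl (g := fun _ => stepE W p q s.2
      (if (s.2 = goodOp k l ↔ d l ≤ lay s.1) then lay s.1 + 1 else lay s.1))]
    · simp only [Bool.not_eq_false]
      rw [Finset.sum_const, card_true', nsmul_eq_mul, Nat.cast_sub (lay_le _)]
    · intro v hv
      have := (Finset.mem_filter.1 hv).2
      rw [Bool.not_eq_false] at this
      rw [move_true hf hl s.1 v s.2 h1 h2 this]

/-- From a layer-based Lyapunov function to the bound on the expected number of phases. -/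
lemma phases_le (hn : 0 < n) (hf : SeqOpt n k d f) (hl : l ≤ k)
    (hp : 0 < p) (hp1 : p < 1) (hq : 0 < q) (hq1 : q < 1)
    (W : ℕ → Op → ℝ) (hW : ∀ y o, 0 ≤ W y o) (C : ℝ) (hC : ∀ y o, W y o ≤ C)
    (hdr : ∀ y o, d (l + 1) < y → y < hiB n l d → y ≤ n →
      (y : ℝ) * stepE W p q o (if (o = goodOp k l ↔ y ≤ d l) then y - 1 else y)
      + ((n : ℝ) - y) * stepE W p q o (if (o = goodOp k l ↔ d l ≤ y) then y + 1 else y)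
      ≤ n * W y o)
    (x0 : Point n) (hx0 : n - ones x0 = d l) (s0 : Op)
    (Ω : Type) [MeasurableSpace Ω] (μ : Measure Ω) (X : ℕ → Ω → Point n × Op)
    [IsProbabilityMeasure μ] (hX : IsMMAHH μ X f p q) (h0 : μ {ω | X 0 ω = (x0, s0)} = 1) :
    ∫⁻ ω, ((⨅ j ∈ {j : ℕ | 1 ≤ j ∧ ∃ t ≤ switchTime X j ω,
          (if l = 0 then n - ones (X t ω).1 = d 1
           else n - ones (X t ω).1 = d (l - 1) ∨
                n - ones (X t ω).1 = d (l + 1))},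
        (j : ℕ∞)) : ℝ≥0∞) ∂μ ≤ ENNReal.ofReal (C + 1) := by
  have hC0 : 0 ≤ C := (hW 0 Op.OI).trans (hC 0 Op.OI)
  obtain ⟨b1, b2, b3, b4⟩ := hi_spec hf hl
  set D : Set (Point n × Op) := {s | d (l + 1) < lay s.1 ∧ lay s.1 < hiB n l d} with hD
  have hdrift := drift_tsum hX D (fun s => ENNReal.ofReal (W (lay s.1) s.2))
    (fun s hs => region_drift hn hf hl hp hp1 hq hq1 W hW hdr s hs.1 hs.2)
    (ENNReal.ofReal C) (fun s => ENNReal.ofReal_le_ofReal (hC _ _))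
  have hm0 : ∀ᵐ ω ∂μ, X 0 ω = (x0, s0) := by
    have hms : MeasurableSet {ω | X 0 ω = (x0, s0)} :=
      hX.1 0 (measurableSet_singleton (x0, s0))
    exact (mem_ae_iff_prob_eq_one hms).2 h0
  calc _ ≤ ∫⁻ ω, (∑' t, stay D X t ω * cost (X t ω) (X (t + 1) ω) + 1) ∂μ := by
        refine lintegral_mono_ae ?_
        filter_upwards [hm0, ae_trans hX, ae_switch hX hp hq] with ω w1 w2 w3
        refine path_bound ω w3 D (fun x => if l = 0 then n - ones x = d 1
           else n - ones x = d (l - 1) ∨ n - ones x = d (l + 1)) ?_ ?_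
        · rw [w1]
          change d (l + 1) < n - ones x0 ∧ n - ones x0 < hiB n l d
          rw [hx0]
          exact ⟨b1, b2⟩
        · intro t ht
          obtain ⟨v, hv⟩ := trans_ne_zero (w2 t)
          obtain ⟨c1, c2⟩ := ht
          have hle := lay_le (X (t + 1) ω).1
          have hr : d (l + 1) ≤ lay (X (t + 1) ω).1 ∧ lay (X (t + 1) ω).1 ≤ hiB n l d := by
            rw [← hv]
            cases hb : (X t ω).1 v
            · rw [move_false hf hl _ v _ c1 c2 hb]
              split_ifs <;> omega
            · rw [move_true hf hl _ v _ c1 c2 hb]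
              split_ifs <;> omega
          by_cases e1 : lay (X (t + 1) ω).1 = d (l + 1)
          · right
            split_ifs with hl0
            · subst hl0; exact e1
            · right; exact e1
          · by_cases e2 : lay (X (t + 1) ω).1 = hiB n l d
            · right
              unfold hiB at e2
              split_ifs at e2 ⊢ with hl0
              · omega
              · left; exact e2
            · left
              exact ⟨by omega, by omega⟩
    _ = ∫⁻ ω, (∑' t, stay D X t ω * cost (X t ω) (X (t + 1) ω)) ∂μ + 1 := by
        rw [lintegral_add_right _ measurable_const]
        simp
    _ ≤ ENNReal.ofReal C + 1 := by gcongr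
    _ = ENNReal.ofReal (C + 1) := by
        rw [ENNReal.ofReal_add hC0 zero_le_one, ENNReal.ofReal_one]

end Drift

section Lyapunov

/-- `∏_{i=1}^{m} 1/(1+c/i)` -/
noncomputable def Pf (c : ℝ) : ℕ → ℝ
  | 0 => 1
  | m + 1 => Pf c m / (1 + c / ((m : ℝ) + 1))

lemma Pf_pos {c : ℝ} (hc : 0 ≤ c) (m : ℕ) : 0 < Pf c m := by
  induction m with
  | zero => simp [Pf]
  | succ m ih => unfold Pf; positivity

lemma Pf_anti {c : ℝ} (hc : 0 ≤ c) : Antitone (Pf c) := by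
  refine antitone_nat_of_succ_le fun m => ?_
  have := Pf_pos hc m
  rw [Pf]
  refine div_le_self this.le ?_
  have : 0 ≤ c / ((m : ℝ) + 1) := by positivity
  linarith

lemma Pf_le_one {c : ℝ} (hc : 0 ≤ c) (m : ℕ) : Pf c m ≤ 1 :=
  Pf_anti hc (Nat.zero_le m)

lemma Pf_ge {c : ℝ} (hc : 0 ≤ c) (m : ℕ) : Real.exp (-(c * (harmonic m : ℝ))) ≤ Pf c m := by
  induction m with
  | zero => simp [Pf]
  | succ m ih =>
    rw [Pf, harmonic_succ]
    push_cast
    rw [mul_add, neg_add, Real.exp_add]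
    have h1 : Real.exp (-(c * ((m : ℝ) + 1)⁻¹)) ≤ 1 / (1 + c / ((m : ℝ) + 1)) := by
      rw [Real.exp_neg, ← one_div]
      have h0 : 0 ≤ c / ((m : ℝ) + 1) := by positivity
      apply one_div_le_one_div_of_le (by linarith)
      have := Real.add_one_le_exp (c * ((m : ℝ) + 1)⁻¹)
      rw [div_eq_mul_inv]
      linarith
    rw [div_eq_mul_one_div]
    have := Pf_pos hc m
    gcongr

lemma Pf_sub {g : ℝ} (hg : 0 < g) (hg2 : g ≤ 1 / 2) (n u : ℕ) (hu : 1 ≤ u) (hun : u ≤ n) :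
    (n : ℝ) * Pf (2 * n * g) u ≤
      (1 - g) * (u * Pf (2 * n * g) (u - 1) + ((n : ℝ) - u) * Pf (2 * n * g) u) := by
  obtain ⟨m, rfl⟩ : ∃ m, u = m + 1 := ⟨u - 1, by omega⟩
  have hc : 0 ≤ 2 * n * g := by positivity
  have h : ((m : ℝ) + 1) * Pf (2 * n * g) m = Pf (2 * n * g) (m + 1) * (m + 1 + 2 * n * g) := by
    rw [Pf]
    have : (0 : ℝ) < (m : ℝ) + 1 + 2 * n * g := by positivity
    have h2 : 1 + 2 * n * g / ((m : ℝ) + 1) = ((m : ℝ) + 1 + 2 * n * g) / (m + 1) := by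
      field_simp
    rw [h2]
    field_simp
  simp only [Nat.add_sub_cancel]
  push_cast
  rw [h]
  have hP := Pf_pos hc (m + 1)
  have e : (1 - g) * (Pf (2 * n * g) (m + 1) * (m + 1 + 2 * n * g)
      + ((n : ℝ) - (m + 1)) * Pf (2 * n * g) (m + 1))
      = n * Pf (2 * n * g) (m + 1) + n * Pf (2 * n * g) (m + 1) * (g * (1 - 2 * g)) := by ring
  rw [e]
  have : 0 ≤ n * Pf (2 * n * g) (m + 1) * (g * (1 - 2 * g)) := by
    have : 0 ≤ 1 - 2 * g := by linarith
    positivity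
  linarith

noncomputable def phi (c : ℝ) (n mid y : ℕ) : ℝ :=
  if y = mid then Pf c n / 2 else if y < mid then Pf c y else Pf c (n - y)

lemma phi_ge {c : ℝ} (hc : 0 ≤ c) {n mid : ℕ} (hm : mid ≤ n) (y : ℕ) :
    Pf c n / 2 ≤ phi c n mid y := by
  have := Pf_pos hc n
  unfold phi
  split_ifs with h1 h2
  · exact le_rfl
  · have : Pf c n ≤ Pf c y := Pf_anti hc (by omega)
    linarith
  · have : Pf c n ≤ Pf c (n - y) := Pf_anti hc (by omega)
    linarith

lemma phi_le {c : ℝ} (hc : 0 ≤ c) {n mid : ℕ} (y : ℕ) : phi c n mid y ≤ 1 := by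
  unfold phi
  have := Pf_le_one hc n
  split_ifs
  · linarith
  · exact Pf_le_one hc _
  · exact Pf_le_one hc _

lemma phi_ge' {c : ℝ} (hc : 0 ≤ c) {n mid : ℕ} (hm : mid ≤ n) (y : ℕ) (hy : y ≠ mid) :
    Pf c n ≤ phi c n mid y := by
  unfold phi
  rw [if_neg hy]
  split_ifs with h2
  · exact Pf_anti hc (by omega)
  · exact Pf_anti hc (by omega)

lemma phi_sub {g : ℝ} (hg : 0 < g) (hg2 : g ≤ 1 / 2) {n mid y : ℕ} (hm : mid ≤ n) (hy : 1 ≤ y)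
    (hyn : y ≤ n) (hyn' : mid < y → y < n) :
    (n : ℝ) * phi (2 * n * g) n mid y ≤
      (1 - g) * (y * phi (2 * n * g) n mid (if y ≤ mid then y - 1 else y)
        + ((n : ℝ) - y) * phi (2 * n * g) n mid (if mid ≤ y then y + 1 else y)) := by
  have hc : 0 ≤ 2 * n * g := by positivity
  have hy' : (y : ℝ) ≤ n := by exact_mod_cast hyn
  rcases lt_trichotomy y mid with h | h | h
  · rw [if_pos h.le, if_neg (by omega)]
    simp only [phi, if_neg h.ne, if_pos h, if_neg (show y - 1 ≠ mid by omega),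
      if_pos (show y - 1 < mid by omega)]
    exact Pf_sub hg hg2 n y hy hyn
  · rw [if_pos h.le, if_pos h.ge]
    have h1 := phi_ge' hc hm (y - 1) (by omega)
    have h2 := phi_ge' hc hm (y + 1) (by omega)
    have h3 : phi (2 * n * g) n mid y = Pf (2 * n * g) n / 2 := by simp [phi, h]
    rw [h3]
    have hP := Pf_pos hc n
    have e1 : (y : ℝ) * Pf (2 * n * g) n ≤ y * phi (2 * n * g) n mid (y - 1) := by gcongr
    have e2 : ((n : ℝ) - y) * Pf (2 * n * g) n ≤ (n - y) * phi (2 * n * g) n mid (y + 1) :=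
      mul_le_mul_of_nonneg_left h2 (by linarith)
    have e3 : (n : ℝ) * Pf (2 * n * g) n ≤ y * phi (2 * n * g) n mid (y - 1)
      + (n - y) * phi (2 * n * g) n mid (y + 1) := by linarith
    have e4 : 0 ≤ (n : ℝ) * Pf (2 * n * g) n := by positivity
    nlinarith
  · rw [if_neg (by omega), if_pos h.le]
    have hlt := hyn' h
    simp only [phi, if_neg h.ne', if_neg (show ¬ y < mid by omega),
      if_neg (show y + 1 ≠ mid by omega), if_neg (show ¬ y + 1 < mid by omega)]
    have := Pf_sub hg hg2 n (n - y) (by omega) (by omega)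
    rw [Nat.cast_sub hyn, show n - y - 1 = n - (y + 1) by omega] at this
    refine this.trans (le_of_eq ?_)
    ring

lemma other_ne (o : Op) : other o ≠ o := by cases o <;> simp [other]

lemma other_eq {o G : Op} (h : o ≠ G) : other o = G := by
  cases o <;> cases G <;> simp_all [other]

/-- Lyapunov function for large `n`. -/
noncomputable def W1 (K c : ℝ) (n mid : ℕ) (G : Op) (y : ℕ) (o : Op) : ℝ :=
  if o = G then K * (1 - phi c n mid y) else K - 1

lemma W1_drift {p q K : ℝ} {n mid : ℕ} {G : Op} (hp : 0 < p) (hq : 0 < q)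
    (hg2 : rate p q G ≤ 1 / 2) (hm : mid ≤ n)
    (hK : 4 ≤ K * Pf (2 * n * rate p q G) n) (hK0 : 0 < K) (y : ℕ) (o : Op) (hy : 1 ≤ y)
    (hyn : y ≤ n) (hyn' : mid < y → y < n) :
    (y : ℝ) * stepE (W1 K (2 * n * rate p q G) n mid G) p q o
        (if (o = G ↔ y ≤ mid) then y - 1 else y)
      + ((n : ℝ) - y) * stepE (W1 K (2 * n * rate p q G) n mid G) p q o
        (if (o = G ↔ mid ≤ y) then y + 1 else y)
      ≤ n * W1 K (2 * n * rate p q G) n mid G y o := by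
  have hr : ∀ o, 0 < rate p q o := by intro o; cases o <;> simpa [rate]
  have hy' : (y : ℝ) ≤ n := by exact_mod_cast hyn
  have hc : 0 ≤ 2 * n * rate p q G := by have := hr G; positivity
  by_cases ho : o = G
  · subst ho
    have hs := phi_sub (hr o) hg2 hm hy hyn hyn'
    simp only [true_iff]
    have e : ∀ z, stepE (W1 K (2 * n * rate p q o) n mid o) p q o z
        = K * (1 - (1 - rate p q o) * phi (2 * n * rate p q o) n mid z) := by
      intro z
      simp only [stepE, W1, if_true, if_neg (other_ne o)]
      ring
    rw [e, e]
    simp only [W1, if_true]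
    generalize phi (2 * n * rate p q o) n mid (if y ≤ mid then y - 1 else y) = A at *
    generalize phi (2 * n * rate p q o) n mid (if mid ≤ y then y + 1 else y) = B at *
    have := mul_le_mul_of_nonneg_left hs hK0.le
    linarith
  · have e : ∀ z, stepE (W1 K (2 * n * rate p q G) n mid G) p q o z ≤ K - 1 := by
      intro z
      simp only [stepE, W1, if_neg ho, if_pos (other_eq ho)]
      have h1 := mul_le_mul_of_nonneg_left (phi_ge hc hm z) hK0.le
      have h2 := hr o
      have h3 : 0 ≤ rate p q o * (K * phi (2 * n * rate p q G) n mid z - 2) :=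
        mul_nonneg h2.le (by linarith)
      linarith
    have h1 := mul_le_mul_of_nonneg_left (e (if (o = G ↔ y ≤ mid) then y - 1 else y))
      (Nat.cast_nonneg (α := ℝ) y)
    have h2 := mul_le_mul_of_nonneg_left (e (if (o = G ↔ mid ≤ y) then y + 1 else y))
      (show (0 : ℝ) ≤ n - y by linarith)
    have h3 : W1 K (2 * n * rate p q G) n mid G y o = K - 1 := by simp [W1, ho]
    rw [h3]
    linarith

def rk (lo mid hi : ℕ) (G : Op) (y : ℕ) (o : Op) : ℕ :=
  2 * (if y ≤ mid then y - lo else hi - y) + (if o = G then 0 else 1)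

/-- Lyapunov function for bounded `n`. -/
noncomputable def W2 (L : ℝ) (R lo mid hi : ℕ) (G : Op) (y : ℕ) (o : Op) : ℝ :=
  L ^ R - L ^ (R - rk lo mid hi G y o)

lemma W2_nonneg {L : ℝ} (hL : 1 ≤ L) (R lo mid hi : ℕ) (G : Op) (y : ℕ) (o : Op) :
    0 ≤ W2 L R lo mid hi G y o := by
  unfold W2
  have := pow_le_pow_right₀ hL (Nat.sub_le R (rk lo mid hi G y o))
  linarith

lemma W2_le {L : ℝ} (hL : 1 ≤ L) (R lo mid hi : ℕ) (G : Op) (y : ℕ) (o : Op) :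
    W2 L R lo mid hi G y o ≤ L ^ R := by
  unfold W2
  have : 0 ≤ L ^ (R - rk lo mid hi G y o) := by positivity
  linarith

lemma W2_drift {p q L : ℝ} {n lo mid hi R : ℕ} {G : Op} (hp : 0 < p) (hq : 0 < q)
    (hp1 : p < 1) (hq1 : q < 1) (hL : 1 ≤ L)
    (hLp : 2 * n ≤ p * L) (hLq : 2 * n ≤ q * L) (hR : 2 * n + 3 ≤ R)
    (hhi : hi ≤ n + 1)
    (y : ℕ) (o : Op) (hlo : lo < y) (hyhi : y < hi)
    (hyn : y ≤ n) (hyn' : mid < y → y < n) :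
    (y : ℝ) * stepE (W2 L R lo mid hi G) p q o
        (if (o = G ↔ y ≤ mid) then y - 1 else y)
      + ((n : ℝ) - y) * stepE (W2 L R lo mid hi G) p q o
        (if (o = G ↔ mid ≤ y) then y + 1 else y)
      ≤ n * W2 L R lo mid hi G y o := by
  have hr : ∀ o, 0 < rate p q o := by intro o; cases o <;> simpa [rate]
  have hr1 : ∀ o, rate p q o < 1 := by intro o; cases o <;> simpa [rate]
  have hrL : ∀ o, 2 * n ≤ rate p q o * L := by intro o; cases o <;> simpa [rate]
  have hy' : (y : ℝ) ≤ n := by exact_mod_cast hyn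
  have hgen : ∀ z, stepE (W2 L R lo mid hi G) p q o z
      ≤ 1 + L ^ R - rate p q o * L ^ (R - rk lo mid hi G z (other o)) := by
    intro z
    have h1 := W2_le hL R lo mid hi G z o
    have h2 := mul_le_mul_of_nonneg_left h1 (show 0 ≤ 1 - rate p q o by linarith [hr1 o])
    have h3 := hr1 o
    simp only [stepE]
    rw [show W2 L R lo mid hi G z (other o)
      = L ^ R - L ^ (R - rk lo mid hi G z (other o)) from rfl]
    linarith
  have hgen' : ∀ z, stepE (W2 L R lo mid hi G) p q o z ≤ 1 + L ^ R := by
    intro z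
    have h1 := hgen z
    have : 0 ≤ rate p q o * L ^ (R - rk lo mid hi G z (other o)) := by
      have := hr o; positivity
    linarith
  set m := R - rk lo mid hi G y o with hm
  have hgood : ∀ z, rk lo mid hi G z (other o) + 1 = rk lo mid hi G y o →
      rk lo mid hi G y o ≤ R →
      stepE (W2 L R lo mid hi G) p q o z ≤ 1 + L ^ R - n * (1 + L ^ m) := by
    intro z hz hz2
    have h1 := hgen z
    rw [show R - rk lo mid hi G z (other o) = m + 1 by omega, pow_succ] at h1
    have h2 : (1 : ℝ) ≤ L ^ m := one_le_pow₀ hL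
    have h3 := mul_le_mul_of_nonneg_right (hrL o) (show 0 ≤ L ^ m by linarith)
    have h4 : (n : ℝ) * 1 ≤ n * L ^ m := by gcongr
    linarith
  have hW : W2 L R lo mid hi G y o = L ^ R - L ^ m := rfl
  rw [hW]
  have hq0 : 0 ≤ (n : ℝ) * (1 + L ^ m) := by positivity
  have hrk : rk lo mid hi G y o ≤ R := by
    unfold rk; split_ifs <;> omega
  by_cases hc : y ≤ mid
  · have hz := hgood (if (o = G ↔ y ≤ mid) then y - 1 else y) (by
      by_cases ho : o = G
      · simp only [ho, hc, if_true, rk, if_neg (other_ne G), show y - 1 ≤ mid by omega]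
        omega
      · simp only [ho, hc, if_true, rk, if_pos (other_eq ho), false_iff, not_true, if_false]) hrk
    have h1 := mul_le_mul_of_nonneg_left hz (Nat.cast_nonneg (α := ℝ) y)
    have h2 := mul_le_mul_of_nonneg_left (hgen' (if (o = G ↔ mid ≤ y) then y + 1 else y))
      (show (0 : ℝ) ≤ n - y by linarith)
    have hy1 : (1 : ℝ) ≤ y := by exact_mod_cast (by omega : 1 ≤ y)
    have h3 := mul_le_mul_of_nonneg_right hy1 hq0
    linarith
  · have hlt := hyn' (by omega)
    have hz := hgood (if (o = G ↔ mid ≤ y) then y + 1 else y) (by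
      by_cases ho : o = G
      · simp only [ho, hc, if_true, rk, if_neg (other_ne G), show ¬ (y + 1 ≤ mid) by omega,
          show mid ≤ y by omega, if_false]
        omega
      · simp only [ho, hc, if_true, rk, if_pos (other_eq ho), false_iff, not_true, if_false,
          show mid ≤ y by omega]) hrk
    have h1 := mul_le_mul_of_nonneg_left (hgen' (if (o = G ↔ y ≤ mid) then y - 1 else y))
      (Nat.cast_nonneg (α := ℝ) y)
    have h2 := mul_le_mul_of_nonneg_left hz (show (0 : ℝ) ≤ n - y by linarith)
    have hy1 : (1 : ℝ) ≤ (n : ℝ) - y := by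
      have : (y : ℝ) + 1 ≤ n := by exact_mod_cast hlt
      linarith
    have h3 := mul_le_mul_of_nonneg_right hy1 hq0
    linarith

end Lyapunov

/-- One-phase approximation (Lemma 4 of the paper): starting on the set of local optima
`L_{d_ℓ}` of a `SEQOPT_k` function, the expected number of phases before a neighboring set
of local optima is reached is bounded by a constant. -/
theorem one_phase_approximation (k : ℕ) (a b : ℝ) (ha : 0 < a) (hab : a ≤ b) :
    ∃ C : ℝ, 0 < C ∧
      ∀ (n : ℕ), 3 ≤ n → k ≤ n - 2 →
        ∀ (d : ℕ → ℕ) (f : Point n → ℝ), SeqOpt n k d f →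
          ∀ l, l ≤ k → ∀ (x0 : Point n), n - ones x0 = d l → ∀ s0 : Op,
            ∀ (p q : ℝ), 0 < p → p < 1 → 0 < q → q < 1 →
              a / ((n : ℝ) * Real.log n) ≤ p → p ≤ b / ((n : ℝ) * Real.log n) →
              a / ((n : ℝ) * Real.log n) ≤ q → q ≤ b / ((n : ℝ) * Real.log n) →
              ∀ (Ω : Type) [MeasurableSpace Ω] (μ : Measure Ω) (X : ℕ → Ω → Point n × Op),
                IsProbabilityMeasure μ →
                IsMMAHH μ X f p q →
                μ {ω | X 0 ω = (x0, s0)} = 1 →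
                ∫⁻ ω, ((⨅ j ∈ {j : ℕ | 1 ≤ j ∧ ∃ t ≤ switchTime X j ω,
                      (if l = 0 then n - ones (X t ω).1 = d 1
                       else n - ones (X t ω).1 = d (l - 1) ∨
                            n - ones (X t ω).1 = d (l + 1))},
                    (j : ℕ∞)) : ℝ≥0∞) ∂μ ≤ ENNReal.ofReal C := by
  set K : ℝ := 4 * Real.exp (4 * b) with hK
  set L : ℝ := 8 * b ^ 2 / a with hL
  set R : ℕ := 2 * ⌈2 * b⌉₊ + 3 with hR
  have hb : 0 < b := ha.trans_le hab
  have hK0 : 0 < K := by positivity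
  have hL0 : 0 < L := by positivity
  refine ⟨K + L ^ R + 1, by positivity, ?_⟩
  intro n hn _ d f hf l hl x0 hx0 s0 p q hp hp1 hq hq1 hpa hpb hqa hqb Ω _ μ X hμ hX h0
  obtain ⟨b1, b2, b3, b4⟩ := hi_spec hf hl
  have hn3 : (3 : ℝ) ≤ n := by exact_mod_cast hn
  have hlog : 1 ≤ Real.log n := by
    rw [Real.le_log_iff_exp_le (by linarith)]
    have := Real.exp_one_lt_d9
    linarith
  have hnl : (n : ℝ) ≤ n * Real.log n := by nlinarith
  have hnl0 : (0 : ℝ) < n * Real.log n := by nlinarith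
  have hedge : ∀ y, y < hiB n l d → d l < y → y < n := by
    intro y hy1 hy2
    unfold hiB at hy1
    split_ifs at hy1 with hl0
    · subst hl0; have := hf.1; omega
    · have h2 := hi_spec hf (l := l - 1) (by omega)
      omega
  have hrb : ∀ o, rate p q o ≤ b / (n * Real.log n) := by intro o; cases o <;> simpa [rate]
  have hr0 : ∀ o, 0 < rate p q o := by intro o; cases o <;> simpa [rate]
  by_cases hg : rate p q (goodOp k l) ≤ 1 / 2
  · set c : ℝ := 2 * n * rate p q (goodOp k l) with hc
    have hc0 : 0 ≤ c := by have := hr0 (goodOp k l); positivity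
    have hcH : c * (harmonic n : ℝ) ≤ 4 * b := by
      have h1 := harmonic_le_one_add_log n
      have h2 : c * Real.log n ≤ 2 * b := by
        have := (le_div_iff₀ hnl0).1 (hrb (goodOp k l))
        rw [hc]; linarith
      have h3 : c * (harmonic n : ℝ) ≤ c * (1 + Real.log n) := by gcongr
      have h4 : c * 1 ≤ c * Real.log n := by gcongr
      linarith
    have hKP : 4 ≤ K * Pf c n := by
      have h1 : Real.exp (-(4 * b)) ≤ Pf c n := by
        refine le_trans ?_ (Pf_ge hc0 n)
        apply Real.exp_le_exp.2
        linarith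
      have h2 : K * Real.exp (-(4 * b)) = 4 := by
        rw [hK, mul_assoc, ← Real.exp_add]; simp
      rw [← h2]
      gcongr
    have hK1 : 4 ≤ K := by
      have := Pf_le_one hc0 n
      nlinarith
    refine (phases_le (by omega) hf hl hp hp1 hq hq1 (W1 K c n (d l) (goodOp k l)) ?_ K ?_ ?_
      x0 hx0 s0 Ω μ X hX h0).trans ?_
    · intro y o
      unfold W1
      have := phi_le hc0 (n := n) (mid := d l) y
      split_ifs
      · exact mul_nonneg hK0.le (by linarith)
      · linarith
    · intro y o
      unfold W1
      have := phi_ge hc0 b3 y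
      have := Pf_pos hc0 n
      split_ifs
      · nlinarith
      · linarith
    · intro y o h1 h2 h3
      exact W1_drift hp hq hg b3 hKP hK0 y o (by omega) h3 (hedge y h2)
    · apply ENNReal.ofReal_le_ofReal
      have : 0 ≤ L ^ R := by positivity
      linarith
  · push Not at hg
    have hnb : (n : ℝ) * Real.log n ≤ 2 * b := by
      have := (le_div_iff₀ hnl0).1 (hg.le.trans (hrb (goodOp k l)))
      linarith
    have hn2b : (n : ℝ) ≤ 2 * b := hnl.trans hnb
    have hnR : 2 * n + 3 ≤ R := by
      have : n ≤ ⌈2 * b⌉₊ := by exact_mod_cast hn2b.trans (Nat.le_ceil _)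
      omega
    have hlow : ∀ r, a / (n * Real.log n) ≤ r → 2 * n ≤ r * L := by
      intro r hr
      have h1 : a / (2 * b) ≤ r := (by gcongr : a / (2 * b) ≤ a / (n * Real.log n)).trans hr
      have h2 : a / (2 * b) * L ≤ r * L := by gcongr
      have h3 : a / (2 * b) * L = 4 * b := by rw [hL]; field_simp; ring
      linarith
    have hL1 : 1 ≤ L := by
      have := hlow p hpa
      nlinarith
    refine (phases_le (by omega) hf hl hp hp1 hq hq1
      (W2 L R (d (l + 1)) (d l) (hiB n l d) (goodOp k l)) ?_ (L ^ R) ?_ ?_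
      x0 hx0 s0 Ω μ X hX h0).trans ?_
    · exact fun y o => W2_nonneg hL1 _ _ _ _ _ y o
    · exact fun y o => W2_le hL1 _ _ _ _ _ y o
    · intro y o h1 h2 h3
      exact W2_drift hp hq hp1 hq1 hL1 (hlow p hpa) (hlow q hqa) hnR b4 y o h1 h2 h3 (hedge y h2)
    · apply ENNReal.ofReal_le_ofReal
      linarith
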